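/- On a six-dimensional lorentzian vector space, for a 3-form H and a one-form-valued quantity φ (each sp(1)-component a covector a), the equation 2(H_{μνα} a_β − H_{μνβ} a_α − H_{αβμ} a_ν + H_{αβν} a_μ) = (H_{μβλ} g_{να} − H_{μαλ} g_{νβ} − H_{νβλ} g_{μα} + H_{ναλ} g_{μβ}) a^λ, holding for all indices μ,ν,α,β, is equivalent to H_{μνα} a_β = 0; that is, it holds if and only if H = 0 or a = 0. -/

import Mathlib

/-!
Statement 17: pointwise linear algebra on a six-dimensional lorentzian vector
space `(V, g)`, realised as `Fin 6 → ℝ` with the mostly-plus metric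
`g = diag(-1,1,1,1,1,1)`.  `H` is a 3-form (alternating components `H μ ν α`)
and `a` a covector (a component `φ^{AB}` of the sp(1)-valued one-form `φ`);
indices are raised and lowered with `g`, so `a^λ = g^{λλ} a_λ`.
-/

noncomputable section

/-- Mostly-plus Minkowski metric `diag(-1,1,1,1,1,1)` (diagonal entries). -/
def ηd (μ : Fin 6) : ℝ := if μ = 0 then -1 else 1

/-- metric components `g_{μν}` -/
def gmet (μ ν : Fin 6) : ℝ := if μ = ν then ηd μ else 0

/-- alternating 3-tensor components -/
def Alt3ℝ (T : Fin 6 → Fin 6 → Fin 6 → ℝ) : Prop :=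
  ∀ μ ν ρ, T ν μ ρ = - T μ ν ρ ∧ T μ ρ ν = - T μ ν ρ

/-- The contraction `H_{μνλ} a^λ`. -/
def contraction (H : Fin 6 → Fin 6 → Fin 6 → ℝ) (a : Fin 6 → ℝ) (μ ν : Fin 6) : ℝ :=
  ∑ lam, H μ ν lam * (ηd lam * a lam)

lemma Alt3ℝ.contraction_swap {H : Fin 6 → Fin 6 → Fin 6 → ℝ} (hH : Alt3ℝ H)
    (a : Fin 6 → ℝ) (μ ν : Fin 6) : contraction H a ν μ = - contraction H a μ ν := by
  simp only [contraction, ← Finset.sum_neg_distrib]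
  exact Finset.sum_congr rfl fun l _ => by rw [(hH μ ν l).1]; ring

lemma Alt3ℝ.sum_middle {H : Fin 6 → Fin 6 → Fin 6 → ℝ} (hH : Alt3ℝ H)
    (a : Fin 6 → ℝ) (μ ν : Fin 6) :
    ∑ l, H μ l ν * (ηd l * a l) = - contraction H a μ ν := by
  simp only [contraction, ← Finset.sum_neg_distrib]
  exact Finset.sum_congr rfl fun l _ => by rw [(hH μ ν l).2]; ring

lemma Alt3ℝ.sum_contraction_mul {H : Fin 6 → Fin 6 → Fin 6 → ℝ} (hH : Alt3ℝ H)
    (a : Fin 6 → ℝ) (μ : Fin 6) :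
    ∑ l, contraction H a μ l * (ηd l * a l) = 0 := by
  have h : ∑ l, contraction H a μ l * (ηd l * a l)
      = - ∑ l, contraction H a μ l * (ηd l * a l) := by
    calc ∑ l, contraction H a μ l * (ηd l * a l)
        = ∑ m, (∑ l, H μ l m * (ηd l * a l)) * (ηd m * a m) := by
          simp only [contraction, Finset.sum_mul]
          rw [Finset.sum_comm]
          exact Finset.sum_congr rfl fun l _ => Finset.sum_congr rfl fun m _ => by ring
      _ = - ∑ l, contraction H a μ l * (ηd l * a l) := by
          simp only [hH.sum_middle, neg_mul, Finset.sum_neg_distrib]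
  linarith

lemma sum_gmet_mul (a : Fin 6 → ℝ) (ν : Fin 6) :
    ∑ l, gmet ν l * (ηd l * a l) = a ν := by
  have hη : ηd ν * ηd ν = 1 := by unfold ηd; split_ifs <;> norm_num
  simp only [gmet, ite_mul, zero_mul, Finset.sum_ite_eq, Finset.mem_univ, if_true]
  rw [← mul_assoc, hη, one_mul]

/-- The equation written with the contraction, contracted with `a^β`. -/
lemma two_mul_normSq_mul {H : Fin 6 → Fin 6 → Fin 6 → ℝ} {a : Fin 6 → ℝ} (hH : Alt3ℝ H)
    (hE : ∀ μ ν α β,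
      2 * (H μ ν α * a β - H μ ν β * a α - H α β μ * a ν + H α β ν * a μ)
        = contraction H a μ β * gmet ν α - contraction H a μ α * gmet ν β
          - contraction H a ν β * gmet μ α + contraction H a ν α * gmet μ β)
    (μ ν α : Fin 6) :
    2 * (∑ l, a l * (ηd l * a l)) * H μ ν α
      = 2 * contraction H a μ ν * a α + contraction H a μ α * a ν
        - contraction H a ν α * a μ := by
  have hsum := Finset.sum_congr (rfl : (Finset.univ : Finset (Fin 6)) = Finset.univ)
    fun β _ => congrArg (· * (ηd β * a β)) (hE μ ν α β)
  have hL : ∑ β, 2 * (H μ ν α * a β - H μ ν β * a α - H α β μ * a ν + H α β ν * a μ)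
        * (ηd β * a β)
      = 2 * (H μ ν α * (∑ l, a l * (ηd l * a l)) - a α * contraction H a μ ν
        - a ν * (∑ l, H α l μ * (ηd l * a l)) + a μ * (∑ l, H α l ν * (ηd l * a l))) := by
    simp only [contraction, Finset.mul_sum, ← Finset.sum_sub_distrib, ← Finset.sum_add_distrib]
    exact Finset.sum_congr rfl fun β _ => by ring
  have hR : ∑ β, (contraction H a μ β * gmet ν α - contraction H a μ α * gmet ν β
        - contraction H a ν β * gmet μ α + contraction H a ν α * gmet μ β) * (ηd β * a β)
      = gmet ν α * (∑ l, contraction H a μ l * (ηd l * a l))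
        - contraction H a μ α * (∑ l, gmet ν l * (ηd l * a l))
        - gmet μ α * (∑ l, contraction H a ν l * (ηd l * a l))
        + contraction H a ν α * (∑ l, gmet μ l * (ηd l * a l)) := by
    simp only [Finset.mul_sum, ← Finset.sum_sub_distrib, ← Finset.sum_add_distrib]
    exact Finset.sum_congr rfl fun β _ => by ring
  rw [hL, hR] at hsum
  simp only [hH.sum_contraction_mul, sum_gmet_mul, hH.sum_middle, hH.contraction_swap a μ α,
    hH.contraction_swap a ν α] at hsum
  linarith

lemma eq_zero_of_equation {H : Fin 6 → Fin 6 → Fin 6 → ℝ} {a : Fin 6 → ℝ} (hH : Alt3ℝ H)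
    (hE : ∀ μ ν α β,
      2 * (H μ ν α * a β - H μ ν β * a α - H α β μ * a ν + H α β ν * a μ)
        = contraction H a μ β * gmet ν α - contraction H a μ α * gmet ν β
          - contraction H a ν β * gmet μ α + contraction H a ν α * gmet μ β)
    {k : Fin 6} (hk : a k ≠ 0) (μ ν α : Fin 6) : H μ ν α = 0 := by
  have hC := two_mul_normSq_mul hH hE
  by_cases hn : ∑ l, a l * (ηd l * a l) = 0
  · have hC' : ∀ μ ν α, 2 * contraction H a μ ν * a α + contraction H a μ α * a ν
        - contraction H a ν α * a μ = 0 := fun μ ν α => by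
      rw [← hC, hn]; ring
    have hdiag : ∀ μ, contraction H a μ μ = 0 := fun μ => by
      linarith [hH.contraction_swap a μ μ]
    have hKk : ∀ μ, contraction H a μ k = 0 := fun μ => by
      have h := hC' μ k k
      rw [hdiag] at h
      exact (mul_eq_zero.mp (by linarith : contraction H a μ k * a k = 0)).resolve_right hk
    have hK : ∀ μ ν, contraction H a μ ν = 0 := fun μ ν => by
      have h := hC' μ ν k
      rw [hKk, hKk] at h
      exact (mul_eq_zero.mp (by linarith : contraction H a μ ν * a k = 0)).resolve_right hk
    have hE' : ∀ μ ν α, H μ ν α * a k - H μ ν k * a α - H α k μ * a ν + H α k ν * a μ = 0 :=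
      fun μ ν α => by
        have h := hE μ ν α k
        simp only [hK] at h
        linarith
    have hmid : ∀ μ α, H μ k α = 0 := fun μ α => by
      have h := hE' μ k α
      have h₁ : H μ k k = 0 := by linarith [(hH μ k k).2]
      have h₂ : H α k k = 0 := by linarith [(hH α k k).2]
      have h₃ : H α k μ = - H μ k α := by
        rw [(hH k α μ).1, (hH k μ α).2, (hH k μ α).1]
      rw [h₁, h₂, h₃] at h
      exact (mul_eq_zero.mp (by linarith : H μ k α * a k = 0)).resolve_right hk
    have h := hE' μ ν α
    have h₁ : H μ ν k = 0 := by rw [(hH μ k ν).2, hmid, neg_zero]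
    rw [h₁, hmid, hmid] at h
    exact (mul_eq_zero.mp (by linarith : H μ ν α * a k = 0)).resolve_right hk
  · have h₁ := hC μ ν α
    have h₂ := hC ν α μ
    have h₃ := hC α μ ν
    rw [(hH ν μ α).2, (hH μ ν α).1, neg_neg] at h₂
    rw [(hH μ α ν).1, (hH μ ν α).2, neg_neg] at h₃
    rw [hH.contraction_swap a μ ν] at h₂
    rw [hH.contraction_swap a μ α, hH.contraction_swap a ν α] at h₃
    rw [hH.contraction_swap a μ α] at h₂
    exact (mul_eq_zero.mp
      (by linarith : (∑ l, a l * (ηd l * a l)) * H μ ν α = 0)).resolve_left hn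

/-- For a 3-form `H` and a covector `a` on six-dimensional
lorentzian `(V,g)`, the equation
`2(H_{μνα} a_β - H_{μνβ} a_α - H_{αβμ} a_ν + H_{αβν} a_μ)
  = (H_{μβλ} g_{να} - H_{μαλ} g_{νβ} - H_{νβλ} g_{μα} + H_{ναλ} g_{μβ}) a^λ`
(for all `μ,ν,α,β`) is equivalent to `H_{μνα} a_β = 0`; that is, it holds if
and only if `H = 0` or `a = 0`. -/
theorem threeform_covector_equation_iff (H : Fin 6 → Fin 6 → Fin 6 → ℝ)
    (a : Fin 6 → ℝ) (hH : Alt3ℝ H) :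
    ((∀ μ ν α β,
        2 * (H μ ν α * a β - H μ ν β * a α - H α β μ * a ν + H α β ν * a μ)
          = ∑ lam, (H μ β lam * gmet ν α - H μ α lam * gmet ν β
              - H ν β lam * gmet μ α + H ν α lam * gmet μ β) * (ηd lam * a lam))
      ↔ (∀ μ ν α β, H μ ν α * a β = 0)) ∧
    ((∀ μ ν α β, H μ ν α * a β = 0)
      ↔ ((∀ μ ν α, H μ ν α = 0) ∨ (∀ β, a β = 0))) := by
  have hiff : (∀ μ ν α β, H μ ν α * a β = 0)
      ↔ ((∀ μ ν α, H μ ν α = 0) ∨ (∀ β, a β = 0)) := by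
    constructor
    · intro h
      by_cases ha : ∀ β, a β = 0
      · exact Or.inr ha
      · obtain ⟨k, hk⟩ := not_forall.mp ha
        exact Or.inl fun μ ν α => (mul_eq_zero.mp (h μ ν α k)).resolve_right hk
    · rintro (h | h) μ ν α β <;> simp [h]
  refine ⟨⟨fun h => hiff.mpr ?_, fun h => ?_⟩, hiff⟩
  · by_cases ha : ∀ β, a β = 0
    · exact Or.inr ha
    · obtain ⟨k, hk⟩ := not_forall.mp ha
      refine Or.inl (eq_zero_of_equation hH (fun μ ν α β => ?_) hk)
      rw [h μ ν α β]
      simp only [contraction, Finset.sum_mul, ← Finset.sum_sub_distrib,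
        ← Finset.sum_add_distrib]
      exact Finset.sum_congr rfl fun l _ => by ring
  · rcases hiff.mp h with h | h <;> intro μ ν α β <;> simp [h]
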